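/- Suppose G' (as above) is symmetric with respect to ⟨A,B⟩_τ = Tr(A*Bρ_τ) and G(ρ_τ) = 0, where G is the predual Lindblad operator. Then for all bounded A, ⟨A, G'(A)⟩_τ = −½ ∑_j Tr([W_j,A]* [W_j,A] ρ_τ); in particular ⟨A, G'(A)⟩_τ ≤ 0. -/

import Mathlib

open scoped InnerProductSpace

/-- Trace along a Hilbert basis. -/
noncomputable def traceAlong {H : Type*} [NormedAddCommGroup H]
    [InnerProductSpace ℂ H] [CompleteSpace H]
    (e : HilbertBasis ℕ ℂ H) (T : H →L[ℂ] H) : ℂ :=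
  ∑' i, ⟪e i, T (e i)⟫_ℂ

namespace HilbertBasis

open ContinuousLinearMap (adjoint adjoint_inner_left adjoint_inner_right star_eq_adjoint)

variable {H : Type*} [NormedAddCommGroup H] [InnerProductSpace ℂ H] [CompleteSpace H]
  (e : HilbertBasis ℕ ℂ H)

omit [CompleteSpace H] in
/-- Parseval's identity for squared norms of coefficients. -/
theorem hasSum_norm_inner_sq (x : H) :
    HasSum (fun k => ‖⟪e k, x⟫_ℂ‖ ^ 2) (‖x‖ ^ 2) := by
  have h := Complex.hasSum_re (e.hasSum_inner_mul_inner x x)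
  have h2 : (⟪x, x⟫_ℂ).re = ‖x‖ ^ 2 := by
    rw [inner_self_eq_norm_sq_to_K]; norm_cast
  rw [h2] at h
  refine h.congr_fun ?_
  intro k
  rw [← inner_conj_symm x (e k), mul_comm, Complex.mul_conj, Complex.normSq_eq_norm_sq]
  norm_cast

omit [CompleteSpace H] in
/-- A family of vectors with summable squared norms has coefficients that are square summable
in both indices. -/
theorem summable_norm_inner_sq {v : ℕ → H} (hv : Summable fun i => ‖v i‖ ^ 2) :
    Summable fun p : ℕ × ℕ => ‖⟪e p.2, v p.1⟫_ℂ‖ ^ 2 := by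
  rw [summable_prod_of_nonneg fun _ => sq_nonneg _]
  refine ⟨fun i => (e.hasSum_norm_inner_sq (v i)).summable, ?_⟩
  exact hv.congr fun i => ((e.hasSum_norm_inner_sq (v i)).tsum_eq).symm

omit [CompleteSpace H] in
/-- A bounded operator preserves square summability of norms. -/
theorem summable_norm_sq_apply {v : ℕ → H} (hv : Summable fun i => ‖v i‖ ^ 2)
    (B : H →L[ℂ] H) : Summable fun i => ‖B (v i)‖ ^ 2 := by
  refine Summable.of_nonneg_of_le (fun _ => sq_nonneg _) (fun i => ?_) (hv.mul_left (‖B‖ ^ 2))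
  rw [← mul_pow]
  exact pow_le_pow_left₀ (norm_nonneg _) (B.le_opNorm _) 2

omit [CompleteSpace H] in
theorem summable_inner_apply {v : ℕ → H} (hv : Summable fun i => ‖v i‖ ^ 2)
    (B : H →L[ℂ] H) : Summable fun i => ⟪v i, B (v i)⟫_ℂ := by
  refine Summable.of_norm_bounded (hv.mul_left ‖B‖) fun i => ?_
  calc ‖⟪v i, B (v i)⟫_ℂ‖ ≤ ‖v i‖ * ‖B (v i)‖ := norm_inner_le_norm _ _
    _ ≤ ‖v i‖ * (‖B‖ * ‖v i‖) := by gcongr; exact B.le_opNorm _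
    _ = ‖B‖ * ‖v i‖ ^ 2 := by ring

/-- Cyclicity of the trace, `Tr (B S S) = Tr (S B S)`, for a self-adjoint Hilbert–Schmidt `S`. -/
theorem traceAlong_mul_sq {S : H →L[ℂ] H} (hS : IsSelfAdjoint S)
    (hs : Summable fun i => ‖S (e i)‖ ^ 2) (B : H →L[ℂ] H) :
    traceAlong e (B * (S * S)) = ∑' k, ⟪S (e k), B (S (e k))⟫_ℂ := by
  have hsym : ∀ x y, ⟪S x, y⟫_ℂ = ⟪x, S y⟫_ℂ := fun x y => by
    conv_rhs => rw [← hS.adjoint_eq]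
    rw [adjoint_inner_right]
  set F : ℕ × ℕ → ℂ := fun p => ⟪e p.1, B (S (e p.2))⟫_ℂ * ⟪e p.2, S (e p.1)⟫_ℂ with hF
  have h1 := e.summable_norm_inner_sq hs
  have h2 : Summable fun p : ℕ × ℕ => ‖⟪e p.1, B (S (e p.2))⟫_ℂ‖ ^ 2 :=
    (e.summable_norm_inner_sq (summable_norm_sq_apply hs B)).prod_symm
  have hsum : Summable F := by
    refine Summable.of_norm_bounded (h1.add h2) fun p => ?_
    rw [hF, norm_mul]
    nlinarith [sq_nonneg (‖⟪e p.1, B (S (e p.2))⟫_ℂ‖ - ‖⟪e p.2, S (e p.1)⟫_ℂ‖),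
      sq_nonneg (‖⟪e p.1, B (S (e p.2))⟫_ℂ‖), sq_nonneg (‖⟪e p.2, S (e p.1)⟫_ℂ‖)]
  have hrow : ∀ i, HasSum (fun k => F (i, k)) ⟪e i, (B * (S * S)) (e i)⟫_ℂ := fun i => by
    have h := e.hasSum_inner_mul_inner (S (adjoint B (e i))) (S (e i))
    rw [hsym, adjoint_inner_left] at h
    refine h.congr_fun fun k => ?_
    rw [hF, hsym, adjoint_inner_left]
  have hcol : ∀ k, HasSum (fun i => F (i, k)) ⟪S (e k), B (S (e k))⟫_ℂ := fun k => by
    refine (e.hasSum_inner_mul_inner (S (e k)) (B (S (e k)))).congr_fun fun i => ?_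
    rw [hF, hsym, mul_comm]
  have ha := hsum.hasSum.prod_fiberwise hrow
  have hb := hsum.prod_symm.hasSum.prod_fiberwise hcol
  rw [traceAlong, ha.tsum_eq, hb.tsum_eq]
  exact ((Equiv.prodComm ℕ ℕ).tsum_eq F).symm

/-- Normality of `Q ↦ ∑ᵢ ⟪vᵢ, Q vᵢ⟫` along a weakly convergent series of positive operators
`Cⱼ* Cⱼ`. -/
theorem hasSum_tsum_inner_star_mul_self {v : ℕ → H} (hv : Summable fun i => ‖v i‖ ^ 2)
    {C : ℕ → H →L[ℂ] H} {K : H →L[ℂ] H}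
    (hC : ∀ x, HasSum (fun j => ⟪x, (star (C j) * C j) x⟫_ℂ) ⟪x, K x⟫_ℂ) :
    HasSum (fun j => ∑' i, ⟪v i, (star (C j) * C j) (v i)⟫_ℂ) (∑' i, ⟪v i, K (v i)⟫_ℂ) := by
  have hnorm : ∀ j x, ⟪x, (star (C j) * C j) x⟫_ℂ = ((‖C j x‖ ^ 2 : ℝ) : ℂ) := fun j x => by
    rw [mul_apply_eq_comp, star_eq_adjoint, adjoint_inner_right, inner_self_eq_norm_sq_to_K]
    norm_cast
  have hre : ∀ x, HasSum (fun j => ‖C j x‖ ^ 2) (⟪x, K x⟫_ℂ).re := fun x => by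
    have h := Complex.hasSum_re (hC x)
    simpa only [hnorm, Complex.ofReal_re] using h
  have hsum : Summable fun p : ℕ × ℕ => ‖C p.2 (v p.1)‖ ^ 2 := by
    rw [summable_prod_of_nonneg fun _ => sq_nonneg _]
    refine ⟨fun i => (hre (v i)).summable, ?_⟩
    refine (Complex.hasSum_re (summable_inner_apply hv K).hasSum).summable.congr fun i => ?_
    exact ((hre (v i)).tsum_eq).symm
  have hsumC : Summable fun p : ℕ × ℕ => ⟪v p.1, (star (C p.2) * C p.2) (v p.1)⟫_ℂ := by
    simp only [hnorm]
    exact Complex.hasSum_ofReal.mpr hsum.hasSum |>.summable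
  have ha := hsumC.hasSum.prod_fiberwise fun i => hC (v i)
  rw [ha.tsum_eq]
  have hb := ((Equiv.prodComm ℕ ℕ).hasSum_iff.mpr hsumC.hasSum)
  exact hb.prod_fiberwise fun j => (summable_inner_apply hv (star (C j) * C j)).hasSum

end HilbertBasis

open ContinuousLinearMap (adjoint adjoint_inner_left adjoint_inner_right star_eq_adjoint) in
/-- The weak sum of `[Wⱼ, A]* [Wⱼ, A]` expressed through the weak sums of `Wⱼ* X Wⱼ`. -/
theorem hasSum_inner_star_commutator_mul_self
    {H : Type*} [NormedAddCommGroup H] [InnerProductSpace ℂ H] [CompleteSpace H]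
    {W : ℕ → H →L[ℂ] H} {Y : H →L[ℂ] H}
    (hY : ∀ x y : H, HasSum (fun j => ⟪x, (star (W j) * W j) y⟫_ℂ) ⟪x, Y y⟫_ℂ)
    {Φ' : (H →L[ℂ] H) → (H →L[ℂ] H)}
    (hΦ' : ∀ (A : H →L[ℂ] H) (x y : H),
      HasSum (fun j => ⟪x, (star (W j) * A * W j) y⟫_ℂ) ⟪x, Φ' A y⟫_ℂ)
    (A : H →L[ℂ] H) (x : H) :
    HasSum (fun j => ⟪x, (star (W j * A - A * W j) * (W j * A - A * W j)) x⟫_ℂ)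
      ⟪x, (star A * Y * A - star A * Φ' A - star (Φ' A) * A + Φ' (star A * A)) x⟫_ℂ := by
  have h1 := hY (A x) (A x)
  have h2 := hΦ' A (A x) x
  have h3 := Complex.hasSum_conj'.mpr h2
  have h4 := hΦ' (star A * A) x x
  have h := ((h1.sub h2).sub h3).add h4
  have hK : ⟪x, (star A * Y * A - star A * Φ' A - star (Φ' A) * A + Φ' (star A * A)) x⟫_ℂ =
      ⟪A x, Y (A x)⟫_ℂ - ⟪A x, Φ' A x⟫_ℂ - (starRingEnd ℂ) ⟪A x, Φ' A x⟫_ℂ +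
        ⟪x, Φ' (star A * A) x⟫_ℂ := by
    simp only [sub_apply, add_apply, mul_apply_eq_comp, star_eq_adjoint, inner_add_right,
      adjoint_inner_right, inner_sub_right, inner_conj_symm]
  rw [hK]
  refine h.congr_fun fun j => ?_
  simp only [star_sub, star_mul, sub_apply, mul_apply_eq_comp, star_eq_adjoint, map_sub,
    adjoint_inner_right, inner_sub_right, inner_conj_symm]
  ring

/-- Suppose `G'(A) = Φ'(A) − ½{Y,A}` (with `Φ'(A) = ∑_j W_j* A W_j` weakly,
`Y = ∑_j W_j* W_j`) is symmetric with respect to `⟨A,B⟩_τ = Tr(A* B ρ)` and the predual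
Lindblad operator annihilates `ρ`: `G(ρ) = Φ(ρ) − ½{Y,ρ} = 0` where `Φ(ρ) = ∑_j W_j ρ W_j*`.
Then for all bounded `A`,
`⟨A, G'(A)⟩_τ = −½ ∑_j Tr([W_j,A]* [W_j,A] ρ)`; in particular `re ⟨A, G'(A)⟩_τ ≤ 0`. -/
theorem stmt13
    {H : Type*} [NormedAddCommGroup H] [InnerProductSpace ℂ H] [CompleteSpace H]
    (e : HilbertBasis ℕ ℂ H) (ρhalf ρ : H →L[ℂ] H)
    (hρ : ρ = ρhalf * ρhalf)
    (hpos : ρhalf.IsPositive) (hinj : Function.Injective ρhalf)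
    (htrρ : Summable fun i => (⟪e i, ρ (e i)⟫_ℂ).re)
    (W : ℕ → H →L[ℂ] H) (Y : H →L[ℂ] H)
    (hY : ∀ x y : H, HasSum (fun j => ⟪x, (star (W j) * W j) y⟫_ℂ) ⟪x, Y y⟫_ℂ)
    (Φ' : (H →L[ℂ] H) → (H →L[ℂ] H))
    (hΦ' : ∀ (A : H →L[ℂ] H) (x y : H),
      HasSum (fun j => ⟪x, (star (W j) * A * W j) y⟫_ℂ) ⟪x, Φ' A y⟫_ℂ)
    (hsym : ∀ A B : H →L[ℂ] H,
      traceAlong e (star (Φ' A - (1/2 : ℂ) • (Y * A + A * Y)) * B * ρ) =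
        traceAlong e (star A * (Φ' B - (1/2 : ℂ) • (Y * B + B * Y)) * ρ))
    (Φρ : H →L[ℂ] H)
    (hΦρ : ∀ x y : H, HasSum (fun j => ⟪x, (W j * ρ * star (W j)) y⟫_ℂ) ⟪x, Φρ y⟫_ℂ)
    (hGρ : Φρ - (1/2 : ℂ) • (Y * ρ + ρ * Y) = 0) :
    ∀ A : H →L[ℂ] H,
      HasSum
        (fun j => traceAlong e (star (W j * A - A * W j) * (W j * A - A * W j) * ρ))
        (-2 * traceAlong e (star A * (Φ' A - (1/2 : ℂ) • (Y * A + A * Y)) * ρ)) ∧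
      (traceAlong e (star A * (Φ' A - (1/2 : ℂ) • (Y * A + A * Y)) * ρ)).re ≤ 0 := by
  intro A
  have hS : IsSelfAdjoint ρhalf := hpos.isSelfAdjoint
  have hs : Summable fun i => ‖ρhalf (e i)‖ ^ 2 := by
    refine htrρ.congr fun i => ?_
    rw [hρ, mul_apply_eq_comp]
    nth_rewrite 1 [← hS.adjoint_eq]
    rw [ContinuousLinearMap.adjoint_inner_right, inner_self_eq_norm_sq_to_K]
    norm_cast
  have hsum := fun B => HilbertBasis.summable_inner_apply hs B
  have htr : ∀ B, traceAlong e (B * ρ) = ∑' k, ⟪ρhalf (e k), B (ρhalf (e k))⟫_ℂ := fun B => by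
    rw [hρ, e.traceAlong_mul_sq hS hs]
  obtain ⟨τ, hτ⟩ : ∃ τ : (H →L[ℂ] H) →ₗ[ℂ] ℂ, ∀ B, traceAlong e (B * ρ) = τ B :=
    ⟨{ toFun := fun B => traceAlong e (B * ρ)
       map_add' := fun B C => by
         simp only [htr, add_apply, inner_add_right]
         exact (hsum B).tsum_add (hsum C)
       map_smul' := fun c B => by
         simp only [htr, smul_apply, inner_smul_right, RingHom.id_apply,
           smul_eq_mul]
         exact tsum_mul_left }, fun _ => rfl⟩
  have hone : Φ' 1 = Y := by
    ext y
    refine ext_inner_left ℂ fun x => (hΦ' 1 x y).unique ?_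
    simpa only [mul_one] using hY x y
  have hYstar : star Y = Y := by
    ext y
    refine ext_inner_left ℂ fun x => ?_
    have h := Complex.hasSum_conj'.mpr (hY y x)
    rw [inner_conj_symm, ← ContinuousLinearMap.adjoint_inner_right] at h
    refine h.unique ((hY x y).congr_fun fun j => ?_)
    simp [ContinuousLinearMap.star_eq_adjoint, ContinuousLinearMap.adjoint_inner_right]
  have hzero := hsym 1 (star A * A)
  have hself := hsym A A
  have hnormal := HilbertBasis.hasSum_tsum_inner_star_mul_self hs
    (hasSum_inner_star_commutator_mul_self hY hΦ' A)
  simp only [← htr] at hnormal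
  have hkey : HasSum
      (fun j => traceAlong e (star (W j * A - A * W j) * (W j * A - A * W j) * ρ))
      (-2 * traceAlong e (star A * (Φ' A - (1/2 : ℂ) • (Y * A + A * Y)) * ρ)) := by
    convert hnormal using 1
    simp only [hτ] at hzero hself ⊢
    simp only [hone, star_sub, star_add, star_smul, star_mul, hYstar, mul_sub, sub_mul,
      mul_add, add_mul, mul_smul_comm, smul_mul_assoc, map_sub, map_add, map_smul, smul_eq_mul,
      mul_one, one_mul, star_one, mul_assoc] at hzero hself ⊢
    simp only [one_div, star_inv₀, star_ofNat] at hzero hself ⊢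
    linear_combination hself + hzero
  refine ⟨hkey, ?_⟩
  have hnonneg := (Complex.hasSum_re hkey).nonneg fun j => by
    rw [htr, Complex.re_tsum (hsum _)]
    refine tsum_nonneg fun k => ?_
    rw [mul_apply_eq_comp, ContinuousLinearMap.star_eq_adjoint,
      ContinuousLinearMap.adjoint_inner_right]
    exact inner_self_nonneg (𝕜 := ℂ)
  have hre : (-2 * traceAlong e (star A * (Φ' A - (1/2 : ℂ) • (Y * A + A * Y)) * ρ)).re =
      -2 * (traceAlong e (star A * (Φ' A - (1/2 : ℂ) • (Y * A + A * Y)) * ρ)).re := by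
    simp only [Complex.mul_re, Complex.neg_re, Complex.neg_im, Complex.re_ofNat,
      Complex.im_ofNat, neg_zero, zero_mul, sub_zero]
  rw [hre] at hnonneg
  linarith
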